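/- Let p ∈ {3, 5, 7} be prime, let m ≥ 1 and α ≥ 1 be integers with base-p digits a_1, …, a_α of m not all zero, and let i' be the least index 1 ≤ i' ≤ α with a_{i'} ≠ 0. Then the number of indices k with 0 ≤ k ≤ α−1 such that f_p^k(m) ≡ 2 (mod p) equals #{i : i' < i ≤ α, a_i = 1} + (1 if a_{i'} = 2, else 0). In words: the number of 1s to the left of the rightmost nonzero digit among the first α base-p digits of m equals the number of integers congruent to 2 modulo p in the list m, f_p(m), f_p^2(m), …, f_p^{α−1}(m), except when the rightmost nonzero digit is 2, in which case the list contains exactly one more such integer. -/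

import Mathlib

open Finset

/-- The `i`-th base-`p` digit of `m` (indexed starting at `i = 1`),
so that `m = ∑_{i ≥ 1} (digit p m i) * p^(i-1)`. -/
def digit (p m i : ℕ) : ℕ := m / p ^ (i - 1) % p

/-- `f_p^[α](ℓ)`: the `α`-fold iterate of `f_p(ℓ) = ⌈ℓ/p⌉` applied to `ℓ`. -/
def fIter (p α ℓ : ℕ) : ℕ := (fun x => (x + (p - 1)) / p)^[α] ℓ


theorem fIter_eq_ceil {p : ℕ} (hp : 0 < p) (k m : ℕ) :
    fIter p k m = (m + (p ^ k - 1)) / p ^ k := by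
  induction k with
  | zero => simp [fIter]
  | succ k ih =>
    have hpk : 0 < p ^ k := pow_pos hp k
    have hstep : fIter p (k + 1) m = (fIter p k m + (p - 1)) / p := by
      simp only [fIter, Function.iterate_succ_apply']
    rw [hstep, ih, ← Nat.add_mul_div_right _ _ hpk, Nat.div_div_eq_div_mul, ← pow_succ]
    congr 1
    obtain ⟨q, rfl⟩ : ∃ q, p = q + 1 := ⟨p - 1, by omega⟩
    rw [pow_succ, Nat.add_sub_cancel, mul_add, mul_one, mul_comm ((q + 1) ^ k) q]
    omega

theorem fIter_of_dvd {p k m : ℕ} (hp : 0 < p) (h : p ^ k ∣ m) :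
    fIter p k m = m / p ^ k := by
  have hpk : 0 < p ^ k := pow_pos hp k
  obtain ⟨c, rfl⟩ := h
  rw [fIter_eq_ceil hp, Nat.mul_add_div hpk, Nat.mul_div_cancel_left _ hpk,
    Nat.div_eq_of_lt (by omega), add_zero]

theorem fIter_of_not_dvd {p k m : ℕ} (hp : 0 < p) (h : ¬ p ^ k ∣ m) :
    fIter p k m = m / p ^ k + 1 := by
  have hpk : 0 < p ^ k := pow_pos hp k
  have hmod : m % p ^ k ≠ 0 := fun h0 => h (Nat.dvd_of_mod_eq_zero h0)
  have hlt := Nat.mod_lt m hpk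
  rw [fIter_eq_ceil hp]
  have hsplit : m + (p ^ k - 1) = (m % p ^ k - 1) + p ^ k * (m / p ^ k + 1) := by
    have := Nat.mod_add_div m (p ^ k)
    rw [mul_add, mul_one]
    omega
  rw [hsplit, Nat.add_mul_div_left _ _ hpk, Nat.div_eq_of_lt (by omega), zero_add]

theorem pow_succ_dvd_iff_digit_eq_zero {p k m : ℕ} (h : p ^ k ∣ m) :
    p ^ (k + 1) ∣ m ↔ digit p m (k + 1) = 0 := by
  rw [digit, Nat.add_sub_cancel, ← Nat.dvd_iff_mod_eq_zero, pow_succ,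
    ← Nat.dvd_div_iff_mul_dvd h]

theorem pow_dvd_of_digits_eq_zero {p m n : ℕ}
    (h : ∀ i, 1 ≤ i → i < n + 1 → digit p m i = 0) : p ^ n ∣ m := by
  induction n with
  | zero => simp
  | succ n ih =>
    exact (pow_succ_dvd_iff_digit_eq_zero (ih fun i h1 h2 => h i h1 (by omega))).2
      (h (n + 1) (by omega) (by omega))

theorem add_one_mod_eq_two_iff {p : ℕ} (hp : 3 ≤ p) (x : ℕ) :
    (x + 1) % p = 2 ↔ x % p = 1 := by
  have := Nat.mod_lt x (by omega : 0 < p)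
  rw [Nat.add_mod, Nat.mod_eq_of_lt (by omega : 1 < p)]
  rcases Nat.lt_or_ge (x % p + 1) p with h | h
  · rw [Nat.mod_eq_of_lt h]
    omega
  · have : x % p + 1 = p := by omega
    rw [this, Nat.mod_self]
    omega

/-- Lemma 6 (part for residue 2): if the first `α` base-`p` digits of `m` are not all zero
and `i'` is the least index `1 ≤ i' ≤ α` with `a_i' ≠ 0`, then the number of
`k ∈ {0, …, α−1}` with `f_p^k(m) ≡ 2 (mod p)` equals
`#{i : i' < i ≤ α, a_i = 1}`, plus one more if `a_i' = 2`. -/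
theorem digit_count_lemma_2 (p : ℕ) (hp : p = 3 ∨ p = 5 ∨ p = 7) (m α : ℕ)
    (hm : 1 ≤ m) (hα : 1 ≤ α) (i' : ℕ) (hi'1 : 1 ≤ i') (hi'2 : i' ≤ α)
    (hne : digit p m i' ≠ 0) (hmin : ∀ i, 1 ≤ i → i < i' → digit p m i = 0) :
    ((Finset.range α).filter fun k => fIter p k m % p = 2).card =
      ((Finset.Ioc i' α).filter fun i => digit p m i = 1).card +
        (if digit p m i' = 2 then 1 else 0) := by
  have hp3 : 3 ≤ p := by omega
  have hp0 : 0 < p := by omega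
  obtain ⟨n, rfl⟩ : ∃ n, i' = n + 1 := ⟨i' - 1, by omega⟩
  have hdvd : p ^ n ∣ m := pow_dvd_of_digits_eq_zero hmin
  have hndvd : ¬ p ^ (n + 1) ∣ m := fun h => hne ((pow_succ_dvd_iff_digit_eq_zero hdvd).1 h)
  have hlow : ∀ k ≤ n, fIter p k m % p = digit p m (k + 1) := fun k hk => by
    rw [fIter_of_dvd hp0 ((pow_dvd_pow p hk).trans hdvd), digit, Nat.add_sub_cancel]
  have hhigh : ∀ k, n + 1 ≤ k → (fIter p k m % p = 2 ↔ digit p m (k + 1) = 1) := fun k hk => by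
    rw [fIter_of_not_dvd hp0 fun h => hndvd ((pow_dvd_pow p hk).trans h),
      add_one_mod_eq_two_iff hp3, digit, Nat.add_sub_cancel]
  clear hα
  simp only [Finset.card_filter]
  induction α, hi'2 using Nat.le_induction with
  | base =>
    rw [Finset.sum_range_succ, hlow n le_rfl, Finset.sum_eq_zero, Finset.Ioc_self,
      Finset.sum_empty]
    intro k hk
    have hk' := Finset.mem_range.1 hk
    rw [hlow k hk'.le, hmin (k + 1) (by omega) (by omega)]
    simp
  | succ a ha ih =>
    rw [Finset.sum_range_succ, ih, Finset.sum_Ioc_succ_top ha]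
    simp only [hhigh a ha]
    omega
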